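/- Let (M,d) be a complete separable geodesic metric space with a compact group G acting by isometries, quotient (M*, d*) and quotient map p. Fix p ∈ [1,∞). For any two probability measures μ₀, μ₁ ∈ P_p(M*) with G-invariant lifts μ̂₀ = Λ(μ₀), μ̂₁ = Λ(μ₁), the p-Wasserstein distances agree: W_p(μ̂₀, μ̂₁) = W_p(μ₀, μ₁). In particular the lift Λ : P_p(M*) → P_p(M) is an isometric embedding onto the set of G-invariant measures in P_p(M). -/

import Mathlib

open MeasureTheory Filter Set
open scoped ENNReal

/-- A coupling of two measures. -/
def IsCoupling {X : Type*} [MeasurableSpace X]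
    (π : Measure (X × X)) (μ ν : Measure X) : Prop :=
  π.map Prod.fst = μ ∧ π.map Prod.snd = ν

/-- The `p`-transport cost of a plan. -/
noncomputable def transportCost (p : ℝ) {X : Type*} [PseudoMetricSpace X] [MeasurableSpace X]
    (π : Measure (X × X)) : ℝ≥0∞ :=
  ∫⁻ z, ENNReal.ofReal (dist z.1 z.2 ^ p) ∂π

/-- The minimal `p`-transport cost between two measures. -/
noncomputable def minCost (p : ℝ) {X : Type*} [PseudoMetricSpace X] [MeasurableSpace X]
    (μ ν : Measure X) : ℝ≥0∞ :=
  ⨅ π : {π : Measure (X × X) // IsCoupling π μ ν}, transportCost p π.1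

/-- The `p`-Wasserstein distance between two measures. -/
noncomputable def Wp (p : ℝ) {X : Type*} [PseudoMetricSpace X] [MeasurableSpace X]
    (μ ν : Measure X) : ℝ≥0∞ :=
  minCost p μ ν ^ (1 / p)

/-- `μ` has finite `p`-th moment. -/
def FinMoment (p : ℝ) {X : Type*} [PseudoMetricSpace X] [MeasurableSpace X]
    (μ : Measure X) : Prop :=
  ∃ x₀ : X, (∫⁻ x, ENNReal.ofReal (dist x x₀ ^ p) ∂μ) ≠ ∞


namespace WLift

/-- A countable family in `G` approximating every group element pointwise. -/
lemma exists_countable {M : Type*} [MetricSpace M] [TopologicalSpace.SeparableSpace M] [Nonempty M]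
    {G : Type*} [Group G] [MulAction G M]
    (hiso : ∀ (g : G) (x y : M), dist (g • x) (g • y) = dist x y) :
    ∃ c : ℕ × ℕ × ℕ → G, ∀ (x : M) (g : G) (δ : ℝ), 0 < δ → ∃ i, dist (c i • x) (g • x) < δ := by
  classical
  let u : ℕ → M := TopologicalSpace.denseSeq M
  have hu : DenseRange u := TopologicalSpace.denseRange_denseSeq M
  let P : ℕ × ℕ × ℕ → G → Prop := fun i g => dist (g • u i.1) (u i.2.1) < 1 / ((i.2.2 : ℝ) + 1)
  refine ⟨fun i => if h : ∃ g, P i g then h.choose else 1, fun x g δ hδ => ?_⟩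
  obtain ⟨m, hm⟩ := exists_nat_one_div_lt (show 0 < δ / 4 by positivity)
  have hm0 : 0 < 1 / ((m : ℝ) + 1) := by positivity
  obtain ⟨n, hn⟩ := hu.exists_dist_lt x hm0
  obtain ⟨k, hk⟩ := hu.exists_dist_lt (g • u n) hm0
  have hex : ∃ g, P (n, k, m) g := ⟨g, hk⟩
  refine ⟨(n, k, m), ?_⟩
  simp only [dif_pos hex]
  have h1 : dist (hex.choose • u n) (u k) < 1 / ((m : ℝ) + 1) := hex.choose_spec
  have h2 := hiso hex.choose x (u n)
  have h3 := hiso g x (u n)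
  have t1 := dist_triangle (hex.choose • x) (hex.choose • u n) (g • x)
  have t2 := dist_triangle (hex.choose • u n) (u k) (g • x)
  have t3 := dist_triangle (u k) (g • u n) (g • x)
  rw [dist_comm (u k) (g • u n), dist_comm (g • u n) (g • x)] at t3
  linarith

section
variable {M : Type*} [MetricSpace M] [TopologicalSpace.SeparableSpace M]
    [MeasurableSpace M] [BorelSpace M]
    {G : Type*} [Group G] [MulAction G M]

lemma meas_smul (hiso : ∀ (g : G) (x y : M), dist (g • x) (g • y) = dist x y) (g : G) :
    Measurable (fun x : M => g • x) :=
  (Isometry.of_dist_eq (hiso g)).continuous.measurable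

lemma ball_smul (hiso : ∀ (g : G) (x y : M), dist (g • x) (g • y) = dist x y) (g : G)
    (α : Measure M) (h : α.map (g • ·) = α) (x : M) (r : ℝ) :
    α (Metric.ball (g • x) r) = α (Metric.ball x r) := by
  conv_lhs => rw [← h]
  rw [Measure.map_apply (meas_smul hiso g) measurableSet_ball]
  congr 1
  ext y
  simp [hiso]

lemma ball_le (hiso : ∀ (g : G) (x y : M), dist (g • x) (g • y) = dist x y)
    {ι : Type*} (c : ι → G)
    (hc : ∀ (x : M) (g : G) (δ : ℝ), 0 < δ → ∃ i, dist (c i • x) (g • x) < δ)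
    (α : Measure M) (h : ∀ i, α.map (c i • ·) = α) (x : M) (g : G) (r : ℝ) :
    α (Metric.ball (g • x) r) ≤ α (Metric.ball x r) := by
  have hU : Metric.ball (g • x) r = ⋃ n : ℕ, Metric.ball (g • x) (r - 1 / ((n : ℝ) + 1)) := by
    ext y
    simp only [Metric.mem_ball, mem_iUnion]
    constructor
    · intro hy
      obtain ⟨n, hn⟩ := exists_nat_one_div_lt (sub_pos.2 hy)
      exact ⟨n, by linarith⟩
    · rintro ⟨n, hn⟩
      have : 0 < 1 / ((n : ℝ) + 1) := by positivity
      linarith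
  have hmono : Monotone fun n : ℕ => Metric.ball (g • x) (r - 1 / ((n : ℝ) + 1)) := by
    intro a b hab
    apply Metric.ball_subset_ball
    have : 1 / ((b : ℝ) + 1) ≤ 1 / ((a : ℝ) + 1) := by gcongr
    linarith
  rw [hU, hmono.measure_iUnion]
  refine iSup_le fun n => ?_
  obtain ⟨i, hi⟩ := hc x g (1 / ((n : ℝ) + 1)) (by positivity)
  rw [← ball_smul hiso (c i) α (h i) x r]
  apply measure_mono
  apply Metric.ball_subset_ball'
  rw [dist_comm] at hi
  linarith

lemma ball_eq (hiso : ∀ (g : G) (x y : M), dist (g • x) (g • y) = dist x y)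
    {ι : Type*} (c : ι → G)
    (hc : ∀ (x : M) (g : G) (δ : ℝ), 0 < δ → ∃ i, dist (c i • x) (g • x) < δ)
    (α : Measure M) (h : ∀ i, α.map (c i • ·) = α) (x : M) (g : G) (r : ℝ) :
    α (Metric.ball (g • x) r) = α (Metric.ball x r) := by
  refine le_antisymm (ball_le hiso c hc α h x g r) ?_
  have := ball_le hiso c hc α h (g • x) g⁻¹ r
  rwa [inv_smul_smul] at this

lemma ball_pos (hiso : ∀ (g : G) (x y : M), dist (g • x) (g • y) = dist x y)
    {ι : Type*} [Countable ι] (c : ι → G)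
    (hc : ∀ (x : M) (g : G) (δ : ℝ), 0 < δ → ∃ i, dist (c i • x) (g • x) < δ)
    (α : Measure M) [IsProbabilityMeasure α] (h : ∀ i, α.map (c i • ·) = α) (x : M)
    (hx : ∀ᵐ y ∂α, y ∈ MulAction.orbit G x) (r : ℝ) (hr : 0 < r) :
    α (Metric.ball x r) ≠ 0 := by
  intro h0
  have h1 : α (⋃ i, Metric.ball (c i • x) r) = 0 := by
    rw [measure_iUnion_null_iff]
    intro i
    rw [ball_smul hiso (c i) α (h i) x r, h0]
  have h2 : ∀ᵐ y ∂α, False := by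
    filter_upwards [hx, measure_eq_zero_iff_ae_notMem.1 h1] with y hy hn
    obtain ⟨g, rfl⟩ := hy
    obtain ⟨i, hi⟩ := hc x g r hr
    apply hn
    rw [mem_iUnion]
    refine ⟨i, ?_⟩
    rw [Metric.mem_ball, dist_comm]
    exact hi
  rw [Filter.eventually_false_iff_eq_bot, ae_eq_bot] at h2
  exact IsProbabilityMeasure.ne_zero α h2

lemma meas_D (r : ℝ) : MeasurableSet {z : M × M | dist z.1 z.2 < r} :=
  measurableSet_lt measurable_dist measurable_const

lemma pair_fst (α β : Measure M) [IsProbabilityMeasure α] [IsProbabilityMeasure β] (r : ℝ)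
    (k : ℝ≥0∞) (h : ∀ᵐ x ∂α, β (Metric.ball x r) = k) :
    ((α.prod β).restrict {z : M × M | dist z.1 z.2 < r}).map Prod.fst = k • α := by
  ext s hs
  rw [Measure.map_apply measurable_fst hs, Measure.restrict_apply (measurable_fst hs),
    Measure.prod_apply ((measurable_fst hs).inter (meas_D r))]
  have : ∀ᵐ x ∂α, β (Prod.mk x ⁻¹' (Prod.fst ⁻¹' s ∩ {z : M × M | dist z.1 z.2 < r}))
      = s.indicator (fun _ => k) x := by
    filter_upwards [h] with x hx
    by_cases hxs : x ∈ s
    · rw [indicator_of_mem hxs, ← hx]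
      congr 1
      ext y
      simp [hxs, dist_comm]
    · rw [indicator_of_notMem hxs]
      convert measure_empty (μ := β)
      ext y
      simp [hxs]
  rw [lintegral_congr_ae this, lintegral_indicator hs]
  simp

lemma pair_snd (α β : Measure M) [IsProbabilityMeasure α] [IsProbabilityMeasure β] (r : ℝ)
    (k : ℝ≥0∞) (h : ∀ᵐ y ∂β, α (Metric.ball y r) = k) :
    ((α.prod β).restrict {z : M × M | dist z.1 z.2 < r}).map Prod.snd = k • β := by
  rw [← pair_fst β α r k h, ← Measure.prod_swap (μ := α) (ν := β),
    Measure.restrict_map measurable_swap (meas_D r), Measure.map_map measurable_fst measurable_swap]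
  congr 2
  ext z
  simp [dist_comm]

lemma cond_pair (α β : Measure M) [IsProbabilityMeasure α] [IsProbabilityMeasure β] (r : ℝ)
    (k l : ℝ≥0∞) (h : ∀ᵐ x ∂α, β (Metric.ball x r) = k) (h' : ∀ᵐ y ∂β, α (Metric.ball y r) = l)
    (hk : k ≠ 0) :
    let D := {z : M × M | dist z.1 z.2 < r}
    ((((α.prod β) D)⁻¹ • (α.prod β).restrict D).map Prod.fst = α) ∧
    ((((α.prod β) D)⁻¹ • (α.prod β).restrict D).map Prod.snd = β) := by
  intro D
  have e1 := pair_fst α β r k h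
  have e2 := pair_snd α β r l h'
  have f1 : (α.prod β) D = k := by
    have := congrArg (fun m => m univ) e1
    simpa [Measure.map_apply measurable_fst MeasurableSet.univ] using this
  have f2 : (α.prod β) D = l := by
    have := congrArg (fun m => m univ) e2
    simpa [Measure.map_apply measurable_snd MeasurableSet.univ] using this
  have hD : (α.prod β) D ≠ 0 := f1 ▸ hk
  have hD' : (α.prod β) D ≠ ∞ := measure_ne_top _ _
  rw [Measure.map_smul, Measure.map_smul, e1, e2, ← f1, ← f2, smul_smul,
    ENNReal.inv_mul_cancel hD hD', one_smul, smul_smul, ENNReal.inv_mul_cancel hD hD', one_smul]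
  exact ⟨rfl, rfl⟩

end

open ProbabilityTheory in
lemma exists_kernel {M : Type*} [MetricSpace M] [CompleteSpace M] [TopologicalSpace.SeparableSpace M]
    [MeasurableSpace M] [BorelSpace M] [Nonempty M]
    {G : Type*} [Group G] [MulAction G M]
    (hiso : ∀ (g : G) (x y : M), dist (g • x) (g • y) = dist x y)
    {Q : Type*} [MetricSpace Q] [SecondCountableTopology Q] [MeasurableSpace Q] [BorelSpace Q]
    (pr : M → Q) (hmeas : Measurable pr)
    (hfib : ∀ x y : M, pr x = pr y ↔ y ∈ MulAction.orbit G x)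
    {ι : Type*} [Countable ι] (c : ι → G)
    (ν : Measure M) [IsProbabilityMeasure ν] (hinv : ∀ g : G, ν.map (g • ·) = ν) :
    ∃ κ : Kernel Q M, IsMarkovKernel κ ∧ (ν.map pr).bind κ = ν ∧
      ∀ᵐ q ∂(ν.map pr), (∀ᵐ x ∂(κ q), pr x = q) ∧ ∀ i, (κ q).map (c i • ·) = κ q := by
  have hP : IsProbabilityMeasure (ν.map pr) := Measure.isProbabilityMeasure_map hmeas.aemeasurable
  have hkey : (ν.map pr) ⊗ₘ condDistrib id pr ν = ν.map (fun x => (pr x, x)) :=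
    compProd_map_condDistrib measurable_id.aemeasurable
  refine ⟨condDistrib id pr ν, inferInstance, ?_, ?_⟩
  · rw [← Measure.snd_compProd, hkey, Measure.snd_map_prodMk hmeas]
    exact Measure.map_id
  · refine Filter.Eventually.and ?_ (ae_all_iff.2 fun i => ?_)
    · refine Measure.ae_ae_of_ae_compProd (p := fun z : Q × M => pr z.2 = z.1) ?_
      have hS : MeasurableSet {z : Q × M | pr z.2 = z.1} :=
        measurableSet_eq_fun (hmeas.comp measurable_snd) measurable_fst
      rw [hkey]
      refine (ae_map_iff (by fun_prop) hS).2 ?_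
      exact ae_of_all _ fun x => rfl
    · have hm := meas_smul hiso (c i)
      have : condDistrib id pr ν =ᵐ[ν.map pr] (condDistrib id pr ν).map (c i • ·) := by
        have := hm
        have : IsMarkovKernel ((condDistrib id pr ν).map (c i • ·)) := Kernel.IsMarkovKernel.map _ hm
        apply condDistrib_ae_eq_of_measure_eq_compProd pr measurable_id.aemeasurable
        rw [Measure.compProd_map hm, hkey, Measure.map_map (by fun_prop) (by fun_prop)]
        conv_lhs => rw [← hinv (c i)]
        rw [Measure.map_map (by fun_prop) hm]
        congr 1
        ext x
        · exact ((hfib x (c i • x)).2 ⟨c i, rfl⟩).symm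
        · rfl
      filter_upwards [this] with q hq
      rw [Kernel.map_apply _ hm] at hq
      exact hq.symm

lemma le_step {M : Type*} [MetricSpace M] [CompleteSpace M] [TopologicalSpace.SeparableSpace M]
    [MeasurableSpace M] [BorelSpace M] [Nonempty M]
    {G : Type*} [Group G] [MulAction G M]
    (hiso : ∀ (g : G) (x y : M), dist (g • x) (g • y) = dist x y)
    {Q : Type*} [MetricSpace Q] [SecondCountableTopology Q] [MeasurableSpace Q] [BorelSpace Q]
    (pr : M → Q) (hsurj : Function.Surjective pr) (hmeas : Measurable pr)
    (hfib : ∀ x y : M, pr x = pr y ↔ y ∈ MulAction.orbit G x)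
    (hdist : ∀ x y : M, dist (pr x) (pr y) = ⨅ g : G, dist (g • x) y)
    (p : ℝ) (hp : 1 ≤ p)
    (ν₀ ν₁ : Measure M) [IsProbabilityMeasure ν₀] [IsProbabilityMeasure ν₁]
    (hinv₀ : ∀ g : G, ν₀.map (g • ·) = ν₀) (hinv₁ : ∀ g : G, ν₁.map (g • ·) = ν₁)
    (π : Measure (Q × Q)) (hπ : IsCoupling π (ν₀.map pr) (ν₁.map pr)) (ε : ℝ) (hε : 0 < ε) :
    minCost p ν₀ ν₁ ≤ ∫⁻ z, ENNReal.ofReal ((dist z.1 z.2 + ε) ^ p) ∂π := by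
  obtain ⟨c, hc⟩ := exists_countable (M := M) hiso
  obtain ⟨κ₀, hκ₀, hb₀, hg₀⟩ := exists_kernel hiso pr hmeas hfib c ν₀ hinv₀
  obtain ⟨κ₁, hκ₁, hb₁, hg₁⟩ := exists_kernel hiso pr hmeas hfib c ν₁ hinv₁
  obtain ⟨hπ₀, hπ₁⟩ := hπ
  rw [← hπ₀] at hb₀ hg₀
  rw [← hπ₁] at hb₁ hg₁
  let κ : ProbabilityTheory.Kernel (Q × Q) (M × M) :=
    (κ₀.comap Prod.fst measurable_fst).prod (κ₁.comap Prod.snd measurable_snd)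
  have hκ : ∀ w, κ w = (κ₀ w.1).prod (κ₁ w.2) := fun w => by
    simp [κ, ProbabilityTheory.Kernel.prod_apply]
  let D : Q × Q → Set (M × M) := fun w => {z | dist z.1 z.2 < dist w.1 w.2 + ε}
  have hDm : MeasurableSet {t : (Q × Q) × (M × M) | t.2 ∈ D t.1} := by
    change MeasurableSet {t : (Q × Q) × (M × M) | dist t.2.1 t.2.2 < dist t.1.1 t.1.2 + ε}
    apply measurableSet_lt <;> fun_prop
  let K : Q × Q → Measure (M × M) := fun w => (κ w (D w))⁻¹ • (κ w).restrict (D w)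
  have hK : Measurable K := by
    refine Measure.measurable_of_measurable_coe _ fun A hA => ?_
    have h1 : Measurable fun w => κ w (D w) :=
      ProbabilityTheory.Kernel.measurable_kernel_prodMk_left hDm
    have h2 : Measurable fun w => κ w (A ∩ D w) :=
      ProbabilityTheory.Kernel.measurable_kernel_prodMk_left
        (t := {t : (Q × Q) × (M × M) | t.2 ∈ A} ∩ {t : (Q × Q) × (M × M) | t.2 ∈ D t.1})
        ((measurable_snd hA).inter hDm)
    have : (fun w => K w A) = fun w => (κ w (D w))⁻¹ * κ w (A ∩ D w) := by
      ext w
      simp [K, Measure.restrict_apply hA]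
    rw [this]
    exact h1.inv.mul h2
  have hgood : ∀ᵐ w ∂π, (K w).map Prod.fst = κ₀ w.1 ∧ (K w).map Prod.snd = κ₁ w.2 := by
    filter_upwards [ae_of_ae_map measurable_fst.aemeasurable hg₀,
      ae_of_ae_map measurable_snd.aemeasurable hg₁] with w h0 h1
    obtain ⟨x₀, hx₀⟩ := hsurj w.1
    obtain ⟨y₀, hy₀⟩ := hsurj w.2
    simp only [K, hκ]
    refine cond_pair (κ₀ w.1) (κ₁ w.2) (dist w.1 w.2 + ε)
      (κ₁ w.2 (Metric.ball x₀ (dist w.1 w.2 + ε))) (κ₀ w.1 (Metric.ball y₀ (dist w.1 w.2 + ε)))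
      ?_ ?_ ?_
    · filter_upwards [h0.1] with x hx
      obtain ⟨g, rfl⟩ := (hfib x₀ x).1 (hx₀.trans hx.symm)
      exact ball_eq hiso c hc _ h1.2 x₀ g _
    · filter_upwards [h1.1] with x hx
      obtain ⟨g, rfl⟩ := (hfib y₀ x).1 (hy₀.trans hx.symm)
      exact ball_eq hiso c hc _ h0.2 y₀ g _
    · have hlt : ⨅ g : G, dist (g • x₀) y₀ < dist w.1 w.2 + ε := by
        rw [← hdist, hx₀, hy₀]; linarith
      obtain ⟨g, hg⟩ := exists_lt_of_ciInf_lt hlt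
      rw [← ball_eq hiso c hc _ h1.2 x₀ g]
      have hpos := ball_pos hiso c hc (κ₁ w.2) h1.2 y₀ (by
        filter_upwards [h1.1] with y hy
        exact (hfib y₀ y).1 (hy₀.trans hy.symm)) _ (sub_pos.2 hg)
      intro h
      apply hpos
      refine measure_mono_null (Metric.ball_subset_ball' ?_) h
      rw [dist_comm y₀]
      linarith
  have hcoup : IsCoupling (π.bind K) ν₀ ν₁ := by
    constructor
    · ext s hs
      rw [Measure.map_apply measurable_fst hs,
        Measure.bind_apply (measurable_fst hs) hK.aemeasurable]
      conv_rhs => rw [← hb₀]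
      rw [Measure.bind_apply hs κ₀.measurable.aemeasurable,
        lintegral_map (κ₀.measurable_coe hs) measurable_fst]
      refine lintegral_congr_ae ?_
      filter_upwards [hgood] with w hw
      rw [← hw.1, Measure.map_apply measurable_fst hs]
    · ext s hs
      rw [Measure.map_apply measurable_snd hs,
        Measure.bind_apply (measurable_snd hs) hK.aemeasurable]
      conv_rhs => rw [← hb₁]
      rw [Measure.bind_apply hs κ₁.measurable.aemeasurable,
        lintegral_map (κ₁.measurable_coe hs) measurable_snd]
      refine lintegral_congr_ae ?_
      filter_upwards [hgood] with w hw
      rw [← hw.2, Measure.map_apply measurable_snd hs]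
  refine (iInf_le _ ⟨π.bind K, hcoup⟩).trans ?_
  have hcm : Measurable fun z : M × M => ENNReal.ofReal (dist z.1 z.2 ^ p) := by fun_prop
  simp only [transportCost]
  rw [Measure.lintegral_bind hK.aemeasurable hcm.aemeasurable]
  refine lintegral_mono_ae ?_
  filter_upwards [hgood] with w hw
  have hKu : K w univ = 1 := by
    have := congrArg (fun m => m univ) hw.1
    simpa [Measure.map_apply measurable_fst MeasurableSet.univ] using this
  calc ∫⁻ z, ENNReal.ofReal (dist z.1 z.2 ^ p) ∂(K w)
      ≤ ∫⁻ z, ENNReal.ofReal ((dist w.1 w.2 + ε) ^ p) ∂(K w) := by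
        refine lintegral_mono_ae ?_
        have hDw : MeasurableSet (D w) := meas_D _
        have : ∀ᵐ z ∂(K w), z ∈ D w :=
          Measure.ae_smul_measure (ae_restrict_mem hDw) _
        filter_upwards [this] with z hz
        have hz' : dist z.1 z.2 < dist w.1 w.2 + ε := hz
        gcongr
    _ = _ := by simp [hKu]

lemma minkowski {Q : Type*} [MetricSpace Q] [SecondCountableTopology Q] [MeasurableSpace Q]
    [BorelSpace Q] (p : ℝ) (hp : 1 ≤ p) (π : Measure (Q × Q)) (hπ : π univ = 1)
    (ε : ℝ) (hε : 0 < ε) :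
    (∫⁻ z, ENNReal.ofReal ((dist z.1 z.2 + ε) ^ p) ∂π) ^ (1 / p) ≤
      transportCost p π ^ (1 / p) + ENNReal.ofReal ε := by
  have hp0 : 0 < p := by linarith
  have := ENNReal.lintegral_Lp_add_le (μ := π) (p := p)
    (f := fun z : Q × Q => ENNReal.ofReal (dist z.1 z.2)) (g := fun _ => ENNReal.ofReal ε)
    (by fun_prop) (by fun_prop) hp
  simp only [Pi.add_apply, lintegral_const, hπ, mul_one] at this
  rw [← ENNReal.rpow_mul, mul_one_div_cancel hp0.ne', ENNReal.rpow_one] at this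
  convert this using 4
  · rw [← ENNReal.ofReal_add dist_nonneg hε.le, ENNReal.ofReal_rpow_of_nonneg (by positivity) hp0.le]
  · rw [transportCost]
    congr 1
    ext z
    rw [ENNReal.ofReal_rpow_of_nonneg dist_nonneg hp0.le]

end WLift

/-- Let `(M,d)` be a complete separable geodesic metric space with a compact
group `G` acting by isometries and quotient `(Q, d*)`, quotient map `pr`.  For
`μ₀, μ₁ ∈ P_p(Q)` with `G`-invariant lifts `ν₀, ν₁` (the unique `G`-invariant measures
pushing forward to `μ₀, μ₁`), the `p`-Wasserstein distances agree:
`W_p(ν₀, ν₁) = W_p(μ₀, μ₁)`; hence the lift is an isometric embedding of `P_p(Q)` onto the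
`G`-invariant measures in `P_p(M)`. -/
theorem wasserstein_lift_isometry
    {M : Type*} [MetricSpace M] [CompleteSpace M] [TopologicalSpace.SeparableSpace M]
    [MeasurableSpace M] [BorelSpace M]
    (hgeo : ∀ x y : M, ∃ γ : ℝ → M, γ 0 = x ∧ γ 1 = y ∧
      ∀ s ∈ Icc (0:ℝ) 1, ∀ t ∈ Icc (0:ℝ) 1, dist (γ s) (γ t) = |s - t| * dist x y)
    {G : Type*} [Group G] [TopologicalSpace G] [CompactSpace G] [MulAction G M]
    (hiso : ∀ (g : G) (x y : M), dist (g • x) (g • y) = dist x y)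
    {Q : Type*} [MetricSpace Q] [MeasurableSpace Q] [BorelSpace Q]
    (pr : M → Q) (hsurj : Function.Surjective pr) (hmeas : Measurable pr)
    (hfib : ∀ x y : M, pr x = pr y ↔ y ∈ MulAction.orbit G x)
    (hdist : ∀ x y : M, dist (pr x) (pr y) = ⨅ g : G, dist (g • x) y)
    (p : ℝ) (hp : 1 ≤ p)
    (μ₀ μ₁ : Measure Q) (hμ₀ : IsProbabilityMeasure μ₀) (hμ₁ : IsProbabilityMeasure μ₁)
    (hfin₀ : FinMoment p μ₀) (hfin₁ : FinMoment p μ₁)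
    (ν₀ ν₁ : Measure M) (hν₀ : IsProbabilityMeasure ν₀) (hν₁ : IsProbabilityMeasure ν₁)
    (hinv₀ : ∀ g : G, ν₀.map (g • ·) = ν₀) (hinv₁ : ∀ g : G, ν₁.map (g • ·) = ν₁)
    (hlift₀ : ν₀.map pr = μ₀) (hlift₁ : ν₁.map pr = μ₁) :
    Wp p ν₀ ν₁ = Wp p μ₀ μ₁ := by
  have hp0 : 0 < p := by linarith
  have hne : Nonempty M := nonempty_of_isProbabilityMeasure ν₀
  have hle : ∀ x y, dist (pr x) (pr y) ≤ dist x y := fun x y => by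
    rw [hdist]
    refine (ciInf_le ⟨0, ?_⟩ (1 : G)).trans (by rw [one_smul])
    rintro _ ⟨g, rfl⟩
    exact dist_nonneg
  have hcont : Continuous pr := (LipschitzWith.mk_one hle).continuous
  have hsep : TopologicalSpace.SeparableSpace Q := hsurj.denseRange.separableSpace hcont
  have hsc : SecondCountableTopology Q := UniformSpace.secondCountable_of_separable Q
  subst hlift₀ hlift₁
  apply le_antisymm
  · unfold Wp
    refine ENNReal.rpow_le_rpow (le_iInf fun ⟨π, hπ⟩ => ?_) (by positivity)
    have hπ1 : π univ = 1 := by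
      have := congrArg (fun m => m univ) hπ.1
      simpa [Measure.map_apply measurable_fst MeasurableSet.univ,
        Measure.map_apply hmeas MeasurableSet.univ] using this
    have hinvp : 0 < 1 / p := by positivity
    rw [← ENNReal.rpow_le_rpow_iff hinvp]
    refine ENNReal.le_of_forall_pos_le_add fun ε hε _ => ?_
    have h1 := WLift.le_step hiso pr hsurj hmeas hfib hdist p hp ν₀ ν₁ hinv₀ hinv₁ π hπ ε hε
    have h2 := WLift.minkowski p hp π hπ1 ε hε
    rw [ENNReal.ofReal_coe_nnreal] at h2
    exact (ENNReal.rpow_le_rpow h1 hinvp.le).trans h2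
  · unfold Wp
    refine ENNReal.rpow_le_rpow (le_iInf fun ⟨π, hπ⟩ => ?_) (by positivity)
    have hm2 : Measurable (Prod.map pr pr) := hmeas.prodMap hmeas
    have hcoup : IsCoupling (π.map (Prod.map pr pr)) (ν₀.map pr) (ν₁.map pr) := by
      constructor
      · rw [← hπ.1, Measure.map_map measurable_fst hm2, Measure.map_map hmeas measurable_fst]
        rfl
      · rw [← hπ.2, Measure.map_map measurable_snd hm2, Measure.map_map hmeas measurable_snd]
        rfl
    refine (iInf_le _ ⟨_, hcoup⟩).trans ?_
    simp only [transportCost]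
    rw [lintegral_map (by fun_prop) hm2]
    refine lintegral_mono fun z => ?_
    have := hle z.1 z.2
    simp only [Prod.map_fst, Prod.map_snd]
    gcongr
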